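/- arXiv:1802.04098 — 3 statements merged into one kernel-verified Lean document; each statement's English description precedes it below -/
import Mathlib

section
/- Let K be a metric space equipped with a finite Borel measure μ, let Ξ be a compact metric space, and let v_j, v : K → Ξ (j ∈ ℕ) be Borel measurable functions. Then the following are equivalent: (a) for every bounded continuous function f : K × Ξ → ℝ, ∫_K f(x, v_j(x)) dμ(x) → ∫_K f(x, v(x)) dμ(x) as j → ∞; (b) v_j → v in μ-measure, i.e. for every ε > 0, μ({x ∈ K : dist(v_j(x), v(x)) ≥ ε}) → 0 as j → ∞. -/
open MeasureTheory Filter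
open scoped BoundedContinuousFunction

section

variable {K Ξ : Type*} [MetricSpace K] [MeasurableSpace K] [BorelSpace K]
  [MetricSpace Ξ] [CompactSpace Ξ] [MeasurableSpace Ξ] [BorelSpace Ξ]
  {μ : Measure K} [IsFiniteMeasure μ] {v : ℕ → K → Ξ} {w : K → Ξ}

/-- A bounded continuous function on `K × Ξ` is integrable along a Borel function. -/
lemma integrable_boundedContinuous_graph (f : K × Ξ →ᵇ ℝ) {u : K → Ξ} (hu : Measurable u) :
    Integrable (fun x => f (x, u x)) μ :=
  Integrable.of_bound
    (f.continuous.measurable.comp (measurable_id.prodMk hu)).aestronglyMeasurable ‖f‖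
    (ae_of_all _ fun _ => f.norm_coe_le_norm _)

/-- The function on `K × Ξ` obtained from a bounded continuous map of `K` into `C(Ξ, ℝ)`. -/
noncomputable def uncurryBounded (G : K →ᵇ C(Ξ, ℝ)) : K × Ξ →ᵇ ℝ :=
  BoundedContinuousFunction.ofNormedAddCommGroup (fun p => G p.1 p.2)
    (continuous_eval.comp ((G.continuous.comp continuous_fst).prodMk continuous_snd)) ‖G‖
    fun p => ((G p.1).norm_coe_le_norm p.2).trans (G.norm_coe_le_norm p.1)

/-- Evaluating an integrable `C(Ξ, ℝ)`-valued map along a Borel function changes its integral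
by at most the `L¹` distance if the map is replaced by a bounded continuous one. -/
lemma abs_integral_eval_sub_le {F : K → C(Ξ, ℝ)} {G : K →ᵇ C(Ξ, ℝ)} (hF : Integrable F μ)
    (hG : Integrable G μ) {u : K → Ξ} (hu : Measurable u) :
    |∫ x, F x (u x) ∂μ - ∫ x, uncurryBounded G (x, u x) ∂μ| ≤ ∫ x, ‖F x - G x‖ ∂μ := by
  have hFu : Integrable (fun x => F x (u x)) μ := by
    refine hF.norm.mono' ?_ (ae_of_all _ fun x => (F x).norm_coe_le_norm _)
    exact continuous_eval.comp_aestronglyMeasurable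
      (hF.aestronglyMeasurable.prodMk hu.aestronglyMeasurable)
  rw [← integral_sub hFu (integrable_boundedContinuous_graph _ hu), ← Real.norm_eq_abs]
  exact norm_integral_le_of_norm_le (hF.sub hG).norm
    (ae_of_all _ fun x => (F x - G x).norm_coe_le_norm (u x))

/-- Narrow convergence extends from bounded continuous test functions to integrable maps
into `C(Ξ, ℝ)`. -/
lemma tendsto_integral_eval (hv : ∀ j, Measurable (v j)) (hw : Measurable w)
    (h : ∀ f : K × Ξ →ᵇ ℝ,
      Tendsto (fun j => ∫ x, f (x, v j x) ∂μ) atTop (nhds (∫ x, f (x, w x) ∂μ)))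
    {F : K → C(Ξ, ℝ)} (hF : Integrable F μ) :
    Tendsto (fun j => ∫ x, F x (v j x) ∂μ) atTop (nhds (∫ x, F x (w x) ∂μ)) := by
  rw [Metric.tendsto_atTop]
  intro ε hε
  obtain ⟨G, hFG, hG⟩ := hF.exists_boundedContinuous_integral_sub_le (ε := ε / 3) (by positivity)
  obtain ⟨N, hN⟩ := Metric.tendsto_atTop.1 (h (uncurryBounded G)) (ε / 3) (by positivity)
  refine ⟨N, fun j hj => ?_⟩
  have h₁ := abs_le.1 ((abs_integral_eval_sub_le hF hG (hv j)).trans hFG)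
  have h₂ := abs_le.1 ((abs_integral_eval_sub_le hF hG hw).trans hFG)
  have h₃ := hN j hj
  rw [Real.dist_eq, abs_lt] at h₃ ⊢
  constructor <;> linarith

/-- Narrow convergence of the concentrated Young measures implies convergence in measure. -/
lemma tendstoInMeasure_of_narrow (hv : ∀ j, Measurable (v j)) (hw : Measurable w)
    (h : ∀ f : K × Ξ →ᵇ ℝ,
      Tendsto (fun j => ∫ x, f (x, v j x) ∂μ) atTop (nhds (∫ x, f (x, w x) ∂μ))) :
    TendstoInMeasure μ v atTop w := by
  let Φ : C(Ξ, C(Ξ, ℝ)) := ContinuousMap.curry ⟨fun p => dist p.2 p.1, by fun_prop⟩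
  have hF : Integrable (fun x => Φ (w x)) μ :=
    Integrable.of_bound (Φ.continuous.comp_aestronglyMeasurable hw.aestronglyMeasurable) ‖Φ‖
      (ae_of_all _ fun _ => Φ.norm_coe_le_norm _)
  have hlim : Tendsto (fun j => ∫ x, dist (v j x) (w x) ∂μ) atTop (nhds 0) := by
    simpa [Φ] using tendsto_integral_eval hv hw h hF
  rw [tendstoInMeasure_iff_measureReal_dist]
  intro ε hε
  have hint (j : ℕ) : Integrable (fun x => dist (v j x) (w x)) μ :=
    Integrable.of_bound ((hv j).dist hw).aestronglyMeasurable (Metric.diam (Set.univ : Set Ξ))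
      (ae_of_all _ fun x => by
        simpa using Metric.dist_le_diam_of_mem isCompact_univ.isBounded
          (Set.mem_univ (v j x)) (Set.mem_univ (w x)))
  refine squeeze_zero (fun _ => measureReal_nonneg) (fun j => ?_) (by simpa using hlim.div_const ε)
  rw [le_div_iff₀' hε]
  exact mul_meas_ge_le_integral_of_nonneg (ae_of_all _ fun _ => dist_nonneg) (hint j) ε

/-- Convergence in measure implies narrow convergence of the concentrated Young measures. -/
lemma narrow_of_tendstoInMeasure (hv : ∀ j, Measurable (v j))
    (h : TendstoInMeasure μ v atTop w) (f : K × Ξ →ᵇ ℝ) :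
    Tendsto (fun j => ∫ x, f (x, v j x) ∂μ) atTop (nhds (∫ x, f (x, w x) ∂μ)) := by
  refine tendsto_of_subseq_tendsto fun ns hns => ?_
  obtain ⟨ms, -, hms⟩ := (h.comp hns).exists_seq_tendsto_ae
  refine ⟨ms, tendsto_integral_of_dominated_convergence (fun _ => ‖f‖)
    (fun j => (integrable_boundedContinuous_graph f (hv _)).aestronglyMeasurable)
    (integrable_const _) (fun _ => ae_of_all _ fun _ => f.norm_coe_le_norm _) ?_⟩
  filter_upwards [hms] with x hx
  exact (f.continuous.tendsto (x, w x)).comp (tendsto_const_nhds.prodMk_nhds hx)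

end

/-- Narrow convergence of the Young measures concentrated on Borel functions
`v_j : K → Ξ` (with `Ξ` a compact metric space) to the Young measure concentrated on `v`
is equivalent to convergence `v_j → v` in `μ`-measure. -/
theorem narrow_convergence_concentrated_iff_inMeasure
    {K Ξ : Type*} [MetricSpace K] [MeasurableSpace K] [BorelSpace K]
    [MetricSpace Ξ] [CompactSpace Ξ] [MeasurableSpace Ξ] [BorelSpace Ξ]
    (μ : Measure K) [IsFiniteMeasure μ]
    (v : ℕ → K → Ξ) (w : K → Ξ) (hv : ∀ j, Measurable (v j)) (hw : Measurable w) :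
    (∀ f : K × Ξ →ᵇ ℝ,
        Tendsto (fun j => ∫ x, f (x, v j x) ∂μ) atTop (nhds (∫ x, f (x, w x) ∂μ))) ↔
      (∀ ε > (0 : ℝ),
        Tendsto (fun j => μ {x | ε ≤ dist (v j x) (w x)}) atTop (nhds 0)) := by
  exact ⟨fun h => tendstoInMeasure_iff_dist.1 (tendstoInMeasure_of_narrow hv hw h),
    fun h => narrow_of_tendstoInMeasure hv (tendstoInMeasure_iff_dist.2 h)⟩
end

section
/- Let K be a compact metric space equipped with a finite Borel measure μ and let Ξ be a compact metric space. Then the set of Young measures on K × Ξ relative to μ is sequentially compact for the narrow topology: every sequence ν_j of finite Borel measures on K × Ξ with first marginal equal to μ admits a subsequence ν_{j_k} and a finite Borel measure ν on K × Ξ with first marginal equal to μ such that ∫ f dν_{j_k} → ∫ f dν for every bounded continuous f : K × Ξ → ℝ. -/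
open MeasureTheory Filter
open scoped BoundedContinuousFunction

/-- On a compact metrizable space, every sequence of finite Borel measures of the same mass has a
weakly convergent subsequence. -/
theorem MeasureTheory.FiniteMeasure.exists_tendsto_subseq_of_mass_eq
    {X : Type*} [TopologicalSpace X] [TopologicalSpace.MetrizableSpace X] [CompactSpace X]
    [MeasurableSpace X] [BorelSpace X] (ν : ℕ → FiniteMeasure X) (c : NNReal)
    (hmass : ∀ j, (ν j).mass = c) :
    ∃ φ : ℕ → ℕ, StrictMono φ ∧ ∃ νlim : FiniteMeasure X,
      Tendsto (fun k => ν (φ k)) atTop (nhds νlim) := by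
  rcases isEmpty_or_nonempty X with hX | hX
  · refine ⟨id, strictMono_id, 0, ?_⟩
    have hzero : ∀ j, ν j = 0 := fun j => Subtype.ext (Measure.eq_zero_of_isEmpty _)
    simp [hzero]
  · let : MetricSpace X := TopologicalSpace.metrizableSpaceMetric X
    obtain ⟨P, φ, hφ, hP⟩ := CompactSpace.tendsto_subseq fun j => (ν j).normalize
    refine ⟨φ, hφ, c • P.toFiniteMeasure, ?_⟩
    have heq : ∀ j, ν j = c • (ν j).normalize.toFiniteMeasure := fun j => by
      simpa only [hmass] using (ν j).self_eq_mass_smul_normalize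
    rw [funext fun k => heq (φ k)]
    exact ((ProbabilityMeasure.tendsto_nhds_iff_toFiniteMeasure_tendsto_nhds atTop).mp
      hP).const_smul c

/-- Sequential compactness of the set of Young measures: if `K` is a compact metric space
with a finite Borel measure `μ` and `Ξ` is a compact metric space, then every sequence of
finite Borel measures on `K × Ξ` with first marginal `μ` admits a subsequence converging
narrowly to a finite Borel measure on `K × Ξ` with first marginal `μ`. -/
theorem youngMeasures_sequentially_compact
    {K Ξ : Type*} [MetricSpace K] [CompactSpace K] [MeasurableSpace K] [BorelSpace K]
    [MetricSpace Ξ] [CompactSpace Ξ] [MeasurableSpace Ξ] [BorelSpace Ξ]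
    (μ : Measure K) [IsFiniteMeasure μ]
    (ν : ℕ → Measure (K × Ξ)) [∀ j, IsFiniteMeasure (ν j)]
    (hmarg : ∀ j, (ν j).map Prod.fst = μ) :
    ∃ φ : ℕ → ℕ, StrictMono φ ∧
      ∃ νlim : Measure (K × Ξ), IsFiniteMeasure νlim ∧ νlim.map Prod.fst = μ ∧
        ∀ f : K × Ξ →ᵇ ℝ,
          Tendsto (fun k => ∫ p, f p ∂(ν (φ k))) atTop (nhds (∫ p, f p ∂νlim)) := by
  let N : ℕ → FiniteMeasure (K × Ξ) := fun j => ⟨ν j, inferInstance⟩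
  let M : FiniteMeasure K := ⟨μ, inferInstance⟩
  have hmap : ∀ j, (N j).map Prod.fst = M := fun j => Subtype.ext (hmarg j)
  have hmass : ∀ j, (N j).mass = M.mass := fun j => by
    rw [← hmap j]
    simp [FiniteMeasure.mass, FiniteMeasure.map_apply _ measurable_fst MeasurableSet.univ]
  obtain ⟨φ, hφ, L, hL⟩ := FiniteMeasure.exists_tendsto_subseq_of_mass_eq N M.mass hmass
  have hLmap : L.map Prod.fst = M := by
    have h := FiniteMeasure.tendsto_map_of_tendsto_of_continuous _ _ hL continuous_fst
    simp only [hmap] at h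
    exact tendsto_nhds_unique h tendsto_const_nhds
  exact ⟨φ, hφ, L, inferInstance, congrArg Subtype.val hLmap,
    FiniteMeasure.tendsto_iff_forall_integral_tendsto.mp hL⟩
end

section
/- Let K be a compact metric space equipped with a finite Borel measure μ, let T > 0, and for each k ∈ ℕ let t ↦ ν_k(t) be a map from [0, T] to the set of Young measures on K × [0, 1] relative to μ which is nondecreasing with respect to the order ≼. Then there exist a subsequence (k_j), independent of t, and a map t ↦ ν(t) from [0, T] to the Young measures on K × [0, 1] relative to μ, nondecreasing with respect to ≼, such that for every t ∈ [0, T] the measures ν_{k_j}(t) converge narrowly to ν(t) as j → ∞. -/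
open MeasureTheory Filter
open scoped BoundedContinuousFunction

/-- The partial order `ν₁ ≼ ν₂` on Young measures on `K × [0, 1]`:
`∫ f dν₁ ≤ ∫ f dν₂` for every bounded Borel `f : K × [0, 1] → ℝ` such that `f(x, ·)` is
continuous and nondecreasing on `[0, 1]` for every `x ∈ K`. -/
def YoungLE {K : Type*} [MeasurableSpace K] [TopologicalSpace K]
    (ν₁ ν₂ : Measure (K × Set.Icc (0 : ℝ) 1)) : Prop :=
  ∀ f : K × Set.Icc (0 : ℝ) 1 → ℝ, Measurable f → (∃ C, ∀ p, |f p| ≤ C) →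
    (∀ x : K, Continuous fun ξ : Set.Icc (0 : ℝ) 1 => f (x, ξ)) →
    (∀ x : K, Monotone fun ξ : Set.Icc (0 : ℝ) 1 => f (x, ξ)) →
    ∫ p, f p ∂ν₁ ≤ ∫ p, f p ∂ν₂

open Topology

section RealSequences

theorem exists_strictMono_forall_tendsto_of_abs_le {κ : Type*} [Countable κ] (v : ℕ → κ → ℝ)
    (C : κ → ℝ) (hC : ∀ k i, |v k i| ≤ C i) :
    ∃ φ : ℕ → ℕ, StrictMono φ ∧ ∀ i, ∃ l, Tendsto (fun j => v (φ j) i) atTop (𝓝 l) := by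
  have hK : IsCompact (Set.univ.pi fun i => Set.Icc (-C i) (C i)) :=
    isCompact_univ_pi fun i => isCompact_Icc
  obtain ⟨a, -, φ, hφ, h⟩ := hK.tendsto_subseq (x := v)
    (fun k i _ => abs_le.mp (hC k i))
  exact ⟨φ, hφ, fun i => ⟨a i, (tendsto_pi_nhds.mp h) i⟩⟩

theorem exists_tendsto_hyperfilter_of_abs_le (v : ℕ → ℝ) (C : ℝ) (hC : ∀ k, |v k| ≤ C) :
    ∃ l, Tendsto v (hyperfilter ℕ) (𝓝 l) := by
  obtain ⟨l, -, hl⟩ := (isCompact_Icc (a := -C) (b := C)).ultrafilter_le_nhds'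
    ((hyperfilter ℕ).map v)
    (Ultrafilter.mem_map.mpr (Filter.univ_mem' fun k => abs_le.mp (hC k)))
  exact ⟨l, hl⟩

/-- If a sequence of monotone functions converges along an ultrafilter to `g` and converges
along `atTop` at rational points, then it converges at the continuity points of `g`. -/
theorem tendsto_of_monotone_of_continuousAt (u : ℕ → ℝ → ℝ) (hu : ∀ k, Monotone (u k))
    (g : ℝ → ℝ) (hg : ∀ q : ℚ, Tendsto (fun k => u k q) atTop (𝓝 (g q))) (t : ℝ)
    (ht : ContinuousAt g t) : Tendsto (fun k => u k t) atTop (𝓝 (g t)) := by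
  rw [Metric.tendsto_atTop]
  intro ε hε
  obtain ⟨δ, hδ, h⟩ := Metric.continuousAt_iff.mp ht (ε / 2) (half_pos hε)
  obtain ⟨p, hp₁, hp₂⟩ := exists_rat_btwn (show t - δ < t by linarith)
  obtain ⟨q, hq₁, hq₂⟩ := exists_rat_btwn (show t < t + δ by linarith)
  have hp := abs_lt.mp (h (x := p) (by rw [Real.dist_eq, abs_lt]; constructor <;> linarith))
  have hq := abs_lt.mp (h (x := q) (by rw [Real.dist_eq, abs_lt]; constructor <;> linarith))
  obtain ⟨N, hN⟩ := Metric.tendsto_atTop.mp (hg p) (ε / 2) (half_pos hε)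
  obtain ⟨N', hN'⟩ := Metric.tendsto_atTop.mp (hg q) (ε / 2) (half_pos hε)
  refine ⟨max N N', fun n hn => ?_⟩
  have h₁ := abs_lt.mp (hN n (le_of_max_le_left hn))
  have h₂ := abs_lt.mp (hN' n (le_of_max_le_right hn))
  have h₃ := hu n hp₂.le
  have h₄ := hu n hq₁.le
  rw [Real.dist_eq, abs_lt]
  constructor <;> linarith

/-- Helly's selection principle for a countable family of sequences of monotone functions. -/
theorem exists_strictMono_forall_tendsto_of_monotone {ι : Type*} [Countable ι]
    (u : ι → ℕ → ℝ → ℝ) (C : ι → ℝ) (hC : ∀ i k t, |u i k t| ≤ C i)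
    (hu : ∀ i k, Monotone (u i k)) :
    ∃ φ : ℕ → ℕ, StrictMono φ ∧ ∀ i t, ∃ l, Tendsto (fun j => u i (φ j) t) atTop (𝓝 l) := by
  obtain ⟨φ, hφ, h⟩ := exists_strictMono_forall_tendsto_of_abs_le
    (fun k (p : ι × ℚ) => u p.1 k p.2) (fun p => C p.1) (fun k p => hC p.1 k p.2)
  choose g hg using fun i t =>
    exists_tendsto_hyperfilter_of_abs_le (fun j => u i (φ j) t) (C i) fun j => hC i (φ j) t
  have hgm : ∀ i, Monotone (g i) := fun i s t hst =>
    le_of_tendsto_of_tendsto' (hg i s) (hg i t) fun j => hu i (φ j) hst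
  have hgq : ∀ i (q : ℚ), Tendsto (fun j => u i (φ j) q) atTop (𝓝 (g i q)) := by
    intro i q
    obtain ⟨l, hl⟩ := h (i, q)
    rwa [tendsto_nhds_unique (hg i q) (hl.mono_left Nat.hyperfilter_le_atTop)]
  have hE : (⋃ i, {t | ¬ContinuousAt (g i) t}).Countable :=
    Set.countable_iUnion fun i => (hgm i).countable_not_continuousAt
  have := hE.to_subtype
  obtain ⟨ψ, hψ, h'⟩ := exists_strictMono_forall_tendsto_of_abs_le
    (fun k (p : ι × (⋃ i, {t | ¬ContinuousAt (g i) t} : Set ℝ)) => u p.1 (φ k) p.2)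
    (fun p => C p.1) (fun k p => hC p.1 (φ k) p.2)
  refine ⟨φ ∘ ψ, hφ.comp hψ, fun i t => ?_⟩
  by_cases ht : t ∈ ⋃ i, {t | ¬ContinuousAt (g i) t}
  · exact h' (i, ⟨t, ht⟩)
  · simp only [Set.mem_iUnion, Set.mem_ofPred_eq, not_exists, not_not] at ht
    exact ⟨g i t, (tendsto_of_monotone_of_continuousAt _ (fun j => hu i (φ j)) _ (hgq i) t
      (ht i)).comp hψ.tendsto_atTop⟩

end RealSequences

section Order

variable {K : Type*} [MetricSpace K] [MeasurableSpace K] [BorelSpace K]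

theorem measure_prod_Ici_le_of_isClosed (ν₁ ν₂ : Measure (K × Set.Icc (0 : ℝ) 1))
    [IsFiniteMeasure ν₁] [IsFiniteMeasure ν₂]
    (h : ∀ f : C(K × Set.Icc (0 : ℝ) 1, ℝ), (∀ x, Monotone fun ξ => f (x, ξ)) →
      ∫ p, f p ∂ν₁ ≤ ∫ p, f p ∂ν₂)
    {F : Set K} (hF : IsClosed F) (a : Set.Icc (0 : ℝ) 1) :
    ν₁ (F ×ˢ Set.Ici a) ≤ ν₂ (F ×ˢ Set.Ici a) := by
  rcases F.eq_empty_or_nonempty with rfl | hne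
  · simp
  let W : C(K × Set.Icc (0 : ℝ) 1, ℝ) :=
    ⟨fun p => 1 / (1 + Metric.infDist p.1 F) * min 1 (1 + (p.2 : ℝ) - a), by
      have : ∀ p : K × Set.Icc (0 : ℝ) 1, 1 + Metric.infDist p.1 F ≠ 0 := fun p => by
        have := Metric.infDist_nonneg (x := p.1) (s := F)
        positivity
      have h' := Metric.continuous_infDist_pt F
      fun_prop (disch := assumption)⟩
  have hd₀ : ∀ p : K × Set.Icc (0 : ℝ) 1, 0 ≤ 1 / (1 + Metric.infDist p.1 F) := fun p => by
    have := Metric.infDist_nonneg (x := p.1) (s := F)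
    positivity
  have hd₁ : ∀ p : K × Set.Icc (0 : ℝ) 1, 1 / (1 + Metric.infDist p.1 F) ≤ 1 := fun p => by
    have := Metric.infDist_nonneg (x := p.1) (s := F)
    rw [div_le_one (by positivity)]
    linarith
  have hm₀ : ∀ p : K × Set.Icc (0 : ℝ) 1, 0 ≤ min 1 (1 + (p.2 : ℝ) - a) := fun p =>
    le_min zero_le_one (by linarith [p.2.2.1, a.2.2])
  have hm₁ : ∀ p : K × Set.Icc (0 : ℝ) 1, min 1 (1 + (p.2 : ℝ) - a) ≤ 1 := fun p =>
    min_le_left _ _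
  have hW₀ : ∀ p, 0 ≤ W p := fun p => mul_nonneg (hd₀ p) (hm₀ p)
  have hW₁ : ∀ p, W p ≤ 1 := fun p => mul_le_one₀ (hd₁ p) (hm₀ p) (hm₁ p)
  have hmem : ∀ p ∈ F ×ˢ Set.Ici a, W p = 1 := by
    rintro p ⟨hp, hpa⟩
    have hpa' : (a : ℝ) ≤ p.2 := hpa
    have h₁ : Metric.infDist p.1 F = 0 := Metric.infDist_zero_of_mem hp
    have h₂ : min 1 (1 + (p.2 : ℝ) - a) = 1 := min_eq_left (by linarith)
    simp [W, h₁, h₂]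
  have hnmem : ∀ p ∉ F ×ˢ Set.Ici a, W p < 1 := by
    intro p hp
    by_cases hpF : p.1 ∈ F
    · have hpa : (p.2 : ℝ) < a := lt_of_not_ge fun hpa => hp ⟨hpF, hpa⟩
      calc W p ≤ min 1 (1 + (p.2 : ℝ) - a) := mul_le_of_le_one_left (hm₀ p) (hd₁ p)
        _ ≤ 1 + (p.2 : ℝ) - a := min_le_right _ _
        _ < 1 := by linarith
    · have hpos := (hF.notMem_iff_infDist_pos hne).mp hpF
      calc W p ≤ 1 / (1 + Metric.infDist p.1 F) := mul_le_of_le_one_right (hd₀ p) (hm₁ p)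
        _ < 1 := by
          rw [div_lt_one (by positivity)]
          linarith
  have hS : MeasurableSet (F ×ˢ Set.Ici a) := hF.measurableSet.prod measurableSet_Ici
  have hlim : ∀ (ν : Measure (K × Set.Icc (0 : ℝ) 1)) [IsFiniteMeasure ν],
      Tendsto (fun n : ℕ => ∫ p, (W ^ n) p ∂ν) atTop (𝓝 (ν.real (F ×ˢ Set.Ici a))) := by
    intro ν _
    rw [← integral_indicator_one hS]
    refine tendsto_integral_of_dominated_convergence (fun _ => 1)
      (fun n => (W ^ n).continuous.aestronglyMeasurable) (integrable_const _)
      (fun n => ae_of_all _ fun p => ?_) (ae_of_all _ fun p => ?_)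
    · rw [ContinuousMap.pow_apply, Real.norm_of_nonneg (pow_nonneg (hW₀ p) n)]
      exact pow_le_one₀ (hW₀ p) (hW₁ p)
    · simp only [ContinuousMap.pow_apply]
      by_cases hp : p ∈ F ×ˢ Set.Ici a
      · simp [hmem p hp, hp]
      · simpa [hp] using tendsto_pow_atTop_nhds_zero_of_lt_one (hW₀ p) (hnmem p hp)
  have hle := le_of_tendsto_of_tendsto' (hlim ν₁) (hlim ν₂) fun n => h (W ^ n) fun x ξ η hξη => by
    have hξη' : (ξ : ℝ) ≤ η := hξη
    simp only [ContinuousMap.pow_apply]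
    refine pow_le_pow_left₀ (hW₀ _) (mul_le_mul_of_nonneg_left ?_ (hd₀ (x, ξ))) n
    exact min_le_min_left _ (by simpa using hξη')
  exact (ENNReal.toReal_le_toReal (measure_ne_top _ _) (measure_ne_top _ _)).mp hle

theorem map_fst_restrict_le (ν₁ ν₂ : Measure (K × Set.Icc (0 : ℝ) 1))
    [IsFiniteMeasure ν₁] [IsFiniteMeasure ν₂]
    (h : ∀ f : C(K × Set.Icc (0 : ℝ) 1, ℝ), (∀ x, Monotone fun ξ => f (x, ξ)) →
      ∫ p, f p ∂ν₁ ≤ ∫ p, f p ∂ν₂) (a : Set.Icc (0 : ℝ) 1) :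
    (ν₁.restrict (Prod.snd ⁻¹' Set.Ici a)).map Prod.fst ≤
      (ν₂.restrict (Prod.snd ⁻¹' Set.Ici a)).map Prod.fst := by
  have hmap : ∀ (ν : Measure (K × Set.Icc (0 : ℝ) 1)) {B : Set K}, MeasurableSet B →
      (ν.restrict (Prod.snd ⁻¹' Set.Ici a)).map Prod.fst B = ν (B ×ˢ Set.Ici a) := by
    intro ν B hB
    rw [Measure.map_apply measurable_fst hB, Measure.restrict_apply (measurable_fst hB),
      Set.prod_eq]
  refine Measure.le_iff.mpr fun A hA => ?_
  rw [hA.measure_eq_iSup_isClosed_of_ne_top (measure_ne_top _ _)]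
  refine iSup₂_le fun F hFA => iSup_le fun hF => ?_
  calc _ = ν₁ (F ×ˢ Set.Ici a) := hmap ν₁ hF.measurableSet
    _ ≤ ν₂ (F ×ˢ Set.Ici a) := measure_prod_Ici_le_of_isClosed ν₁ ν₂ h hF a
    _ ≤ ν₂ (A ×ˢ Set.Ici a) := measure_mono (Set.prod_mono_left hFA)
    _ = _ := (hmap ν₂ hA).symm

theorem integral_indicator_snd_le (ν₁ ν₂ : Measure (K × Set.Icc (0 : ℝ) 1))
    [IsFiniteMeasure ν₁] [IsFiniteMeasure ν₂]
    (h : ∀ f : C(K × Set.Icc (0 : ℝ) 1, ℝ), (∀ x, Monotone fun ξ => f (x, ξ)) →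
      ∫ p, f p ∂ν₁ ≤ ∫ p, f p ∂ν₂) (a : Set.Icc (0 : ℝ) 1)
    {d : K → ℝ} (hd : Measurable d) (hd₀ : 0 ≤ d) {C : ℝ} (hdC : ∀ x, |d x| ≤ C) :
    ∫ p, (Prod.snd ⁻¹' Set.Ici a).indicator (fun p => d p.1) p ∂ν₁ ≤
      ∫ p, (Prod.snd ⁻¹' Set.Ici a).indicator (fun p => d p.1) p ∂ν₂ := by
  have hS : MeasurableSet (Prod.snd ⁻¹' Set.Ici a : Set (K × Set.Icc (0 : ℝ) 1)) :=
    measurable_snd measurableSet_Ici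
  rw [integral_indicator hS, integral_indicator hS,
    ← integral_map (f := d) measurable_fst.aemeasurable hd.aestronglyMeasurable,
    ← integral_map (f := d) measurable_fst.aemeasurable hd.aestronglyMeasurable]
  exact integral_mono_measure (map_fst_restrict_le ν₁ ν₂ h a) (ae_of_all _ hd₀)
    (Integrable.of_bound hd.aestronglyMeasurable C (ae_of_all _ hdC))

/-- The grid point `i / (n + 1)`, truncated to `[0, 1]`. -/
noncomputable def unitGrid (n i : ℕ) : Set.Icc (0 : ℝ) 1 :=
  Set.projIcc 0 1 zero_le_one ((i : ℝ) / ((n + 1 : ℕ) : ℝ))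

theorem unitGrid_mono (n : ℕ) : Monotone (unitGrid n) := fun i j hij =>
  Set.monotone_projIcc _ (by gcongr)

theorem unitGrid_le_iff {n i : ℕ} (hi : i < n + 1) (ξ : Set.Icc (0 : ℝ) 1) :
    unitGrid n (i + 1) ≤ ξ ↔ i < ⌊(ξ : ℝ) * ((n + 1 : ℕ) : ℝ)⌋₊ := by
  have hn : (0 : ℝ) < ((n + 1 : ℕ) : ℝ) := by positivity
  have hmem : ((i + 1 : ℕ) : ℝ) / ((n + 1 : ℕ) : ℝ) ∈ Set.Icc (0 : ℝ) 1 :=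
    ⟨by positivity, (div_le_one hn).mpr (by exact_mod_cast hi)⟩
  rw [unitGrid, Set.projIcc_of_mem _ hmem, ← Subtype.coe_le_coe, div_le_iff₀ hn,
    ← Nat.le_floor_iff (mul_nonneg ξ.2.1 hn.le), Nat.succ_le_iff]

theorem tendsto_unitGrid_floor (ξ : Set.Icc (0 : ℝ) 1) :
    Tendsto (fun n : ℕ => unitGrid n ⌊(ξ : ℝ) * ((n + 1 : ℕ) : ℝ)⌋₊) atTop (𝓝 ξ) := by
  have h := ((tendsto_nat_floor_mul_div_atTop ξ.2.1).comp
    (tendsto_natCast_atTop_atTop (R := ℝ))).comp (tendsto_add_atTop_nat 1)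
  have h' := (continuous_projIcc (h := zero_le_one (α := ℝ))).continuousAt.tendsto.comp h
  rwa [Set.projIcc_val] at h'

theorem apply_unitGrid_floor_eq_add_sum (g : Set.Icc (0 : ℝ) 1 → ℝ) (n : ℕ)
    (ξ : Set.Icc (0 : ℝ) 1) :
    g (unitGrid n ⌊(ξ : ℝ) * ((n + 1 : ℕ) : ℝ)⌋₊) = g (unitGrid n 0) +
      ∑ i ∈ Finset.range (n + 1),
        if unitGrid n (i + 1) ≤ ξ then g (unitGrid n (i + 1)) - g (unitGrid n i) else 0 := by
  set m := ⌊(ξ : ℝ) * ((n + 1 : ℕ) : ℝ)⌋₊ with hm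
  have hmn : m ≤ n + 1 := by
    rw [hm]
    exact Nat.floor_le_of_le (mul_le_of_le_one_left (by positivity) ξ.2.2)
  have : ∑ i ∈ Finset.range (n + 1),
      (if unitGrid n (i + 1) ≤ ξ then g (unitGrid n (i + 1)) - g (unitGrid n i) else 0) =
      ∑ i ∈ Finset.range m, (g (unitGrid n (i + 1)) - g (unitGrid n i)) := by
    rw [← Finset.sum_filter]
    refine Finset.sum_congr ?_ fun _ _ => rfl
    ext i
    simp only [Finset.mem_filter, Finset.mem_range]
    constructor
    · rintro ⟨hi, h⟩
      exact (unitGrid_le_iff hi ξ).mp h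
    · intro hi
      exact ⟨hi.trans_le hmn, (unitGrid_le_iff (hi.trans_le hmn) ξ).mpr hi⟩
  rw [this, Finset.sum_range_sub fun i => g (unitGrid n i)]
  ring

/-- For measures with equal first marginals, the order `≼` only has to be tested on continuous
functions. -/
theorem youngLE_of_forall_continuousMap (ν₁ ν₂ : Measure (K × Set.Icc (0 : ℝ) 1))
    [IsFiniteMeasure ν₁] [IsFiniteMeasure ν₂] (hν : ν₁.map Prod.fst = ν₂.map Prod.fst)
    (h : ∀ f : C(K × Set.Icc (0 : ℝ) 1, ℝ), (∀ x, Monotone fun ξ => f (x, ξ)) →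
      ∫ p, f p ∂ν₁ ≤ ∫ p, f p ∂ν₂) :
    YoungLE ν₁ ν₂ := by
  rintro f hf ⟨C, hC⟩ hcont hmono
  have hfm : ∀ ξ, Measurable fun x => f (x, ξ) := fun ξ => hf.comp measurable_prodMk_right
  have hd : ∀ n i : ℕ, Measurable fun x =>
      f (x, unitGrid n (i + 1)) - f (x, unitGrid n i) := fun n i => (hfm _).sub (hfm _)
  have hdC : ∀ (n i : ℕ) (x : K), |f (x, unitGrid n (i + 1)) - f (x, unitGrid n i)| ≤ C + C :=
    fun n i x => (abs_sub _ _).trans (add_le_add (hC _) (hC _))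
  have hstep : ∀ (n : ℕ) (p : K × Set.Icc (0 : ℝ) 1),
      f (p.1, unitGrid n ⌊(p.2 : ℝ) * ((n + 1 : ℕ) : ℝ)⌋₊) = f (p.1, unitGrid n 0) +
        ∑ i ∈ Finset.range (n + 1), (Prod.snd ⁻¹' Set.Ici (unitGrid n (i + 1))).indicator
          (fun p : K × Set.Icc (0 : ℝ) 1 =>
            f (p.1, unitGrid n (i + 1)) - f (p.1, unitGrid n i)) p := fun n p => by
    rw [apply_unitGrid_floor_eq_add_sum (fun ξ => f (p.1, ξ)) n p.2]
    congr 1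
  have hmeas : ∀ n i : ℕ, Measurable
      ((Prod.snd ⁻¹' Set.Ici (unitGrid n (i + 1))).indicator (fun p : K × Set.Icc (0 : ℝ) 1 =>
        f (p.1, unitGrid n (i + 1)) - f (p.1, unitGrid n i))) := fun n i =>
    ((hd n i).comp measurable_fst).indicator (measurable_snd measurableSet_Ici)
  have hint₀ : ∀ (ν : Measure (K × Set.Icc (0 : ℝ) 1)) [IsFiniteMeasure ν] (n : ℕ),
      Integrable (fun p : K × Set.Icc (0 : ℝ) 1 => f (p.1, unitGrid n 0)) ν := fun ν _ n =>
    Integrable.of_bound ((hfm _).comp measurable_fst).aestronglyMeasurable C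
      (ae_of_all _ fun p => hC _)
  have hint : ∀ (ν : Measure (K × Set.Icc (0 : ℝ) 1)) [IsFiniteMeasure ν] (n i : ℕ),
      Integrable ((Prod.snd ⁻¹' Set.Ici (unitGrid n (i + 1))).indicator
        (fun p : K × Set.Icc (0 : ℝ) 1 =>
          f (p.1, unitGrid n (i + 1)) - f (p.1, unitGrid n i))) ν := fun ν _ n i =>
    Integrable.of_bound (hmeas n i).aestronglyMeasurable (C + C)
      (ae_of_all _ fun p => (norm_indicator_le_norm_self _ _).trans (hdC n i p.1))
  have hlim : ∀ (ν : Measure (K × Set.Icc (0 : ℝ) 1)) [IsFiniteMeasure ν],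
      Tendsto (fun n : ℕ => ∫ p, f (p.1, unitGrid n ⌊(p.2 : ℝ) * ((n + 1 : ℕ) : ℝ)⌋₊) ∂ν)
        atTop (𝓝 (∫ p, f p ∂ν)) := by
    intro ν _
    refine tendsto_integral_of_dominated_convergence (fun _ => C) (fun n => ?_)
      (integrable_const _) (fun n => ae_of_all _ fun p => hC _) (ae_of_all _ fun p => ?_)
    · simp_rw [hstep n]
      exact ((hint₀ ν n).add (integrable_finsetSum _ fun i _ => hint ν n i)).aestronglyMeasurable
    · exact ((hcont p.1).tendsto p.2).comp (tendsto_unitGrid_floor p.2)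
  refine le_of_tendsto_of_tendsto' (hlim ν₁) (hlim ν₂) fun n => ?_
  simp_rw [hstep n]
  rw [integral_add (hint₀ ν₁ n) (integrable_finsetSum _ fun i _ => hint ν₁ n i),
    integral_add (hint₀ ν₂ n) (integrable_finsetSum _ fun i _ => hint ν₂ n i),
    integral_finsetSum _ fun i _ => hint ν₁ n i, integral_finsetSum _ fun i _ => hint ν₂ n i]
  refine add_le_add (le_of_eq ?_) (Finset.sum_le_sum fun i _ => ?_)
  · have hmap := fun ν : Measure (K × Set.Icc (0 : ℝ) 1) =>
      integral_map (μ := ν) measurable_fst.aemeasurable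
        (hfm (unitGrid n 0)).aestronglyMeasurable
    rw [← hmap ν₁, ← hmap ν₂, hν]
  · exact integral_indicator_snd_le ν₁ ν₂ h _ (hd n i)
      (fun x => sub_nonneg.mpr (hmono x (unitGrid_mono n i.le_succ))) (hdC n i)

theorem map_fst_eq_of_tendsto_integral (μ : Measure K) [IsFiniteMeasure μ]
    (m : ℕ → Measure (K × Set.Icc (0 : ℝ) 1)) (hm : ∀ j, (m j).map Prod.fst = μ)
    (ν : Measure (K × Set.Icc (0 : ℝ) 1)) [IsFiniteMeasure ν]
    (hν : ∀ g : C(K × Set.Icc (0 : ℝ) 1, ℝ),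
      Tendsto (fun j => ∫ p, g p ∂(m j)) atTop (𝓝 (∫ p, g p ∂ν))) :
    ν.map Prod.fst = μ := by
  refine ext_of_forall_integral_eq_of_IsFiniteMeasure fun f => ?_
  have hmap := fun m : Measure (K × Set.Icc (0 : ℝ) 1) =>
    integral_map (μ := m) measurable_fst.aemeasurable f.continuous.aestronglyMeasurable
  have h := hν ⟨fun p => f p.1, by fun_prop⟩
  simp only [ContinuousMap.coe_mk, ← hmap, hm] at h
  exact tendsto_nhds_unique h tendsto_const_nhds

end Order

section Convergence

theorem abs_integral_le_norm_mul {X : Type*} [TopologicalSpace X] [CompactSpace X]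
    [MeasurableSpace X] (m : Measure X) [IsFiniteMeasure m] {M : ℝ} (hM : m.real Set.univ ≤ M)
    (f : C(X, ℝ)) : |∫ p, f p ∂m| ≤ ‖f‖ * M :=
  (norm_integral_le_of_norm_le_const (ae_of_all _ f.norm_coe_le_norm)).trans
    (mul_le_mul_of_nonneg_left hM (norm_nonneg f))

variable {X : Type*} [TopologicalSpace X] [CompactSpace X] [MeasurableSpace X]

theorem isClosed_setOf_tendsto_integral [OpensMeasurableSpace X] (m : ℕ → Measure X)
    [∀ j, IsFiniteMeasure (m j)] (ν : Measure X) [IsFiniteMeasure ν] {M : ℝ}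
    (hm : ∀ j, (m j).real Set.univ ≤ M) (hν : ν.real Set.univ ≤ M) :
    IsClosed {f : C(X, ℝ) | Tendsto (fun j => ∫ p, f p ∂(m j)) atTop (𝓝 (∫ p, f p ∂ν))} := by
  have hM : 0 ≤ M := measureReal_nonneg.trans hν
  have hint : ∀ (f : C(X, ℝ)) (ν : Measure X) [IsFiniteMeasure ν], Integrable f ν :=
    fun f ν _ => Integrable.of_bound f.continuous.aestronglyMeasurable ‖f‖
      (ae_of_all _ f.norm_coe_le_norm)
  have hsub : ∀ (f g : C(X, ℝ)) (ν : Measure X) [IsFiniteMeasure ν], ν.real Set.univ ≤ M →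
      |∫ p, f p ∂ν - ∫ p, g p ∂ν| ≤ dist f g * M := fun f g ν _ h => by
    rw [← integral_sub (hint f ν) (hint g ν), dist_eq_norm]
    exact abs_integral_le_norm_mul ν h (f - g)
  refine isClosed_of_closure_subset fun f hf => Metric.tendsto_atTop.mpr fun ε hε => ?_
  obtain ⟨g, hg, hfg⟩ := Metric.mem_closure_iff.mp hf (ε / (3 * (M + 1))) (by positivity)
  obtain ⟨N, hN⟩ := Metric.tendsto_atTop.mp hg (ε / 3) (by positivity)
  have hle : dist f g * M ≤ ε / 3 := by
    calc dist f g * M ≤ ε / (3 * (M + 1)) * (M + 1) := by gcongr; linarith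
      _ = ε / 3 := by field_simp
  refine ⟨N, fun n hn => ?_⟩
  have h₁ := abs_le.mp ((hsub f g (m n) (hm n)).trans hle)
  have h₂ := abs_le.mp ((hsub f g ν hν).trans hle)
  have h₃ := abs_lt.mp (hN n hn)
  rw [Real.dist_eq, abs_lt]
  constructor <;> linarith

end Convergence

section FiberwiseLipschitz

variable (K : Type*) [MetricSpace K]

/-- The algebra of continuous functions on `K × [0, 1]` that are Lipschitz in the second variable,
uniformly with respect to the first one. -/
def fiberwiseLipschitz [CompactSpace K] : Subalgebra ℝ C(K × Set.Icc (0 : ℝ) 1, ℝ) where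
  carrier := {f | ∃ L : ℝ, ∀ x ξ η, |f (x, ξ) - f (x, η)| ≤ L * |(ξ : ℝ) - η|}
  mul_mem' := by
    rintro f g ⟨L, hL⟩ ⟨L', hL'⟩
    refine ⟨‖f‖ * L' + ‖g‖ * L, fun x ξ η => ?_⟩
    have h : f (x, ξ) * g (x, ξ) - f (x, η) * g (x, η) =
        f (x, ξ) * (g (x, ξ) - g (x, η)) + g (x, η) * (f (x, ξ) - f (x, η)) := by ring
    simp only [ContinuousMap.mul_apply, h]
    calc _ ≤ |f (x, ξ)| * |g (x, ξ) - g (x, η)| + |g (x, η)| * |f (x, ξ) - f (x, η)| := by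
          rw [← abs_mul, ← abs_mul]
          exact abs_add_le _ _
      _ ≤ ‖f‖ * (L' * |(ξ : ℝ) - η|) + ‖g‖ * (L * |(ξ : ℝ) - η|) :=
          add_le_add
            (mul_le_mul (f.norm_coe_le_norm _) (hL' x ξ η) (abs_nonneg _) (norm_nonneg _))
            (mul_le_mul (g.norm_coe_le_norm _) (hL x ξ η) (abs_nonneg _) (norm_nonneg _))
      _ = _ := by ring
  add_mem' := by
    rintro f g ⟨L, hL⟩ ⟨L', hL'⟩
    refine ⟨L + L', fun x ξ η => ?_⟩
    simp only [ContinuousMap.add_apply, add_sub_add_comm, add_mul]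
    exact (abs_add_le _ _).trans (add_le_add (hL x ξ η) (hL' x ξ η))
  algebraMap_mem' r := ⟨0, fun x ξ η => by simp⟩

theorem fiberwiseLipschitz_topologicalClosure [CompactSpace K] :
    (fiberwiseLipschitz K).topologicalClosure = ⊤ := by
  refine ContinuousMap.subalgebra_topologicalClosure_eq_top_of_separatesPoints _ ?_
  intro p q hpq
  by_cases h : p.1 = q.1
  · refine ⟨_, ⟨⟨fun p => (p.2 : ℝ), by fun_prop⟩, ⟨1, fun x ξ η => by simp⟩, rfl⟩, ?_⟩
    exact fun h' => hpq (Prod.ext h (Subtype.ext h'))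
  · refine ⟨_, ⟨⟨fun r => dist r.1 q.1, by fun_prop⟩, ⟨0, fun x ξ η => by simp⟩, rfl⟩, ?_⟩
    simpa using h

variable {K}

theorem exists_eq_sub_monotone_of_mem_fiberwiseLipschitz [CompactSpace K]
    {f : C(K × Set.Icc (0 : ℝ) 1, ℝ)} (hf : f ∈ fiberwiseLipschitz K) :
    ∃ g h : C(K × Set.Icc (0 : ℝ) 1, ℝ), (∀ x, Monotone fun ξ => g (x, ξ)) ∧
      (∀ x, Monotone fun ξ => h (x, ξ)) ∧ f = g - h := by
  obtain ⟨L, hL⟩ := hf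
  let h : C(K × Set.Icc (0 : ℝ) 1, ℝ) := ⟨fun p => |L| * p.2, by fun_prop⟩
  refine ⟨f + h, h, fun x ξ η hξη => ?_, fun x ξ η hξη => ?_, by simp⟩
  all_goals
    have hξη' : (ξ : ℝ) ≤ η := hξη
  · have h₁ := hL x ξ η
    have h₂ : L * |(ξ : ℝ) - η| ≤ |L| * (η - ξ) := by
      rw [abs_sub_comm, abs_of_nonneg (sub_nonneg.mpr hξη')]
      exact mul_le_mul_of_nonneg_right (le_abs_self L) (sub_nonneg.mpr hξη')
    have h₃ := (le_abs_self _).trans (h₁.trans h₂)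
    simp only [ContinuousMap.add_apply, h, ContinuousMap.coe_mk]
    linarith
  · exact mul_le_mul_of_nonneg_left hξη' (abs_nonneg L)

end FiberwiseLipschitz

section Limit

variable {K : Type*} [MetricSpace K] [CompactSpace K] [MeasurableSpace K] [BorelSpace K]

theorem exists_measure_tendsto_integral (m : ℕ → Measure (K × Set.Icc (0 : ℝ) 1))
    [∀ j, IsFiniteMeasure (m j)] {M : ℝ} (hm : ∀ j, (m j).real Set.univ ≤ M)
    (f : ℕ → {f : C(K × Set.Icc (0 : ℝ) 1, ℝ) // ∀ x, Monotone fun ξ => f (x, ξ)})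
    (hf : DenseRange f) (hlim : ∀ i, ∃ l, Tendsto (fun j => ∫ p, (f i).1 p ∂(m j)) atTop (𝓝 l)) :
    ∃ ν : Measure (K × Set.Icc (0 : ℝ) 1), IsFiniteMeasure ν ∧
      ∀ g : C(K × Set.Icc (0 : ℝ) 1, ℝ),
        Tendsto (fun j => ∫ p, g p ∂(m j)) atTop (𝓝 (∫ p, g p ∂ν)) := by
  have hM : 0 ≤ M := measureReal_nonneg.trans (hm 0)
  let m' : ℕ → FiniteMeasure (K × Set.Icc (0 : ℝ) 1) := fun j => ⟨m j, inferInstance⟩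
  obtain ⟨ν, hνM, hν⟩ := (isCompact_setOfPred_finiteMeasure_le_of_compactSpace
    (K × Set.Icc (0 : ℝ) 1) ⟨M, hM⟩).ultrafilter_le_nhds' ((hyperfilter ℕ).map m')
      (Ultrafilter.mem_map.mpr (Filter.univ_mem' hm))
  have hν' := FiniteMeasure.tendsto_iff_forall_integral_tendsto.mp
    (show Tendsto m' (hyperfilter ℕ) (𝓝 ν) from hν)
  refine ⟨ν, inferInstance, ?_⟩
  have hclosed := isClosed_setOf_tendsto_integral m (ν : Measure (K × Set.Icc (0 : ℝ) 1)) hm hνM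
  have hmono : ∀ g : {f : C(K × Set.Icc (0 : ℝ) 1, ℝ) // ∀ x, Monotone fun ξ => f (x, ξ)},
      Tendsto (fun j => ∫ p, g.1 p ∂(m j)) atTop
        (𝓝 (∫ p, g.1 p ∂(ν : Measure (K × Set.Icc (0 : ℝ) 1)))) := by
    refine fun g => hf.induction_on (p := fun g => g.1 ∈ {f : C(K × Set.Icc (0 : ℝ) 1, ℝ) |
      Tendsto (fun j => ∫ p, f p ∂(m j)) atTop
        (𝓝 (∫ p, f p ∂(ν : Measure (K × Set.Icc (0 : ℝ) 1))))}) g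
      (hclosed.preimage continuous_subtype_val) fun i => ?_
    obtain ⟨l, hl⟩ := hlim i
    have h := tendsto_nhds_unique (hl.mono_left Nat.hyperfilter_le_atTop)
      (hν' (BoundedContinuousFunction.mkOfCompact (f i).1))
    rw [h] at hl
    exact hl
  intro g
  have hg : g ∈ (fiberwiseLipschitz K).topologicalClosure := by
    simp [fiberwiseLipschitz_topologicalClosure K]
  refine closure_minimal (fun g hg => ?_) hclosed hg
  obtain ⟨g₁, g₂, h₁, h₂, rfl⟩ := exists_eq_sub_monotone_of_mem_fiberwiseLipschitz hg
  have hint : ∀ (g : C(K × Set.Icc (0 : ℝ) 1, ℝ)) (ν : Measure (K × Set.Icc (0 : ℝ) 1))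
      [IsFiniteMeasure ν], Integrable g ν := fun g ν _ =>
    Integrable.of_bound g.continuous.aestronglyMeasurable ‖g‖ (ae_of_all _ g.norm_coe_le_norm)
  simpa [integral_sub (hint g₁ _) (hint g₂ _)] using (hmono ⟨g₁, h₁⟩).sub (hmono ⟨g₂, h₂⟩)

/-- Helly's selection principle for nondecreasing families indexed by the real line. -/
theorem helly_young_measures_real (μ : Measure K) [IsFiniteMeasure μ]
    (ν : ℕ → ℝ → Measure (K × Set.Icc (0 : ℝ) 1)) (hmarg : ∀ k t, (ν k t).map Prod.fst = μ)
    (hmono : ∀ k s t, s ≤ t → YoungLE (ν k s) (ν k t)) :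
    ∃ φ : ℕ → ℕ, StrictMono φ ∧ ∃ νlim : ℝ → Measure (K × Set.Icc (0 : ℝ) 1),
      (∀ t, (νlim t).map Prod.fst = μ) ∧ (∀ s t, s ≤ t → YoungLE (νlim s) (νlim t)) ∧
      ∀ t, ∀ f : C(K × Set.Icc (0 : ℝ) 1, ℝ),
        Tendsto (fun j => ∫ p, f p ∂(ν (φ j) t)) atTop (𝓝 (∫ p, f p ∂(νlim t))) := by
  have huniv : ∀ k t, ν k t Set.univ = μ Set.univ := fun k t => by
    rw [← hmarg k t, Measure.map_apply measurable_fst MeasurableSet.univ, Set.preimage_univ]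
  have hfin : ∀ k t, IsFiniteMeasure (ν k t) := fun k t =>
    ⟨by rw [huniv]; exact measure_lt_top _ _⟩
  have hM : ∀ k t, (ν k t).real Set.univ ≤ μ.real Set.univ := fun k t => by
    simp [Measure.real, huniv]
  have hmonoC : ∀ k s t, s ≤ t → ∀ f : C(K × Set.Icc (0 : ℝ) 1, ℝ),
      (∀ x, Monotone fun ξ => f (x, ξ)) → ∫ p, f p ∂(ν k s) ≤ ∫ p, f p ∂(ν k t) :=
    fun k s t hst f hf => hmono k s t hst f f.continuous.measurable
      ⟨‖f‖, f.norm_coe_le_norm⟩ (fun x => by fun_prop) hf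
  have : Nonempty {f : C(K × Set.Icc (0 : ℝ) 1, ℝ) // ∀ x, Monotone fun ξ => f (x, ξ)} :=
    ⟨0, fun x => monotone_const⟩
  obtain ⟨f, hf⟩ := TopologicalSpace.exists_dense_seq
    {f : C(K × Set.Icc (0 : ℝ) 1, ℝ) // ∀ x, Monotone fun ξ => f (x, ξ)}
  obtain ⟨φ, hφ, hlim⟩ := exists_strictMono_forall_tendsto_of_monotone
    (fun i k t => ∫ p, (f i).1 p ∂(ν k t)) (fun i => ‖(f i).1‖ * μ.real Set.univ)
    (fun i k t => abs_integral_le_norm_mul (ν k t) (hM k t) (f i).1)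
    (fun i k s t hst => hmonoC k s t hst (f i).1 (f i).2)
  choose νlim hνfin hνlim using fun t => exists_measure_tendsto_integral
    (fun j => ν (φ j) t) (fun j => hM (φ j) t) f hf fun i => hlim i t
  have hνmarg : ∀ t, (νlim t).map Prod.fst = μ := fun t =>
    map_fst_eq_of_tendsto_integral μ _ (fun j => hmarg (φ j) t) _ (hνlim t)
  refine ⟨φ, hφ, νlim, hνmarg, fun s t hst => ?_, hνlim⟩
  exact youngLE_of_forall_continuousMap _ _ ((hνmarg s).trans (hνmarg t).symm) fun g hg =>
    le_of_tendsto_of_tendsto' (hνlim s g) (hνlim t g) fun j => hmonoC (φ j) s t hst g hg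

end Limit

/-- Helly selection principle for Young measures: from any sequence of maps
`t ↦ ν_k(t)` from `[0, T]` to the Young measures on `K × [0, 1]` relative to `μ`,
nondecreasing with respect to `≼`, one can extract a subsequence (independent of `t`)
converging narrowly, for every `t ∈ [0, T]`, to a `≼`-nondecreasing map `t ↦ ν(t)` with
values in the Young measures on `K × [0, 1]` relative to `μ`. -/
theorem helly_young_measures
    {K : Type*} [MetricSpace K] [CompactSpace K] [MeasurableSpace K] [BorelSpace K]
    (μ : Measure K) [IsFiniteMeasure μ] (T : ℝ) (hT : 0 < T)
    (ν : ℕ → ℝ → Measure (K × Set.Icc (0 : ℝ) 1))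
    (hmarg : ∀ k, ∀ t ∈ Set.Icc (0 : ℝ) T, (ν k t).map Prod.fst = μ)
    (hmono : ∀ k, ∀ s ∈ Set.Icc (0 : ℝ) T, ∀ t ∈ Set.Icc (0 : ℝ) T, s ≤ t →
      YoungLE (ν k s) (ν k t)) :
    ∃ φ : ℕ → ℕ, StrictMono φ ∧
      ∃ νlim : ℝ → Measure (K × Set.Icc (0 : ℝ) 1),
        (∀ t ∈ Set.Icc (0 : ℝ) T, (νlim t).map Prod.fst = μ) ∧
        (∀ s ∈ Set.Icc (0 : ℝ) T, ∀ t ∈ Set.Icc (0 : ℝ) T, s ≤ t →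
          YoungLE (νlim s) (νlim t)) ∧
        ∀ t ∈ Set.Icc (0 : ℝ) T, ∀ f : K × Set.Icc (0 : ℝ) 1 →ᵇ ℝ,
          Tendsto (fun j => ∫ p, f p ∂(ν (φ j) t)) atTop (nhds (∫ p, f p ∂(νlim t))) := by
  let π : ℝ → ℝ := fun t => Set.projIcc 0 T hT.le t
  have hπ : ∀ t, π t ∈ Set.Icc (0 : ℝ) T := fun t => (Set.projIcc 0 T hT.le t).2
  have hπ' : ∀ t ∈ Set.Icc (0 : ℝ) T, π t = t := fun t ht => by
    simp [π, Set.projIcc_of_mem hT.le ht]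
  obtain ⟨φ, hφ, νlim, h₁, h₂, h₃⟩ := helly_young_measures_real μ (fun k t => ν k (π t))
    (fun k t => hmarg k _ (hπ t))
    (fun k s t hst => hmono k _ (hπ s) _ (hπ t) (Set.monotone_projIcc hT.le hst))
  refine ⟨φ, hφ, νlim, fun t _ => h₁ t, fun s _ t _ hst => h₂ s t hst, fun t ht f => ?_⟩
  have h := h₃ t f.toContinuousMap
  rw [hπ' t ht] at h
  exact h
end
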